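/- Suppose η > 1. Then F admits no absolutely continuous stationary probability measure, i.e. there is no Borel probability measure μ on [0,1] that is absolutely continuous with respect to Lebesgue measure λ and satisfies Σ_{j∈Σ} p_j μ(T_j⁻¹A) = μ(A) for all Borel sets A ⊆ [0,1]. -/

import Mathlib

open MeasureTheory Set

/-- Left branch of the LSV-type maps: `x ↦ x(1 + 2^α x^α)`. -/
noncomputable def lsvLeft (α x : ℝ) : ℝ := x * (1 + 2 ^ α * x ^ α)

/-- The LSV map `S_α`. -/
noncomputable def lsvMap (α : ℝ) (x : ℝ) : ℝ :=
  if x ≤ 1 / 2 then lsvLeft α x else 2 * x - 1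

/-- The map `R_{α,K}`. -/
noncomputable def rMap (α K : ℝ) (x : ℝ) : ℝ :=
  if x ≤ 1 / 2 then lsvLeft α x
  else 1 / 2 + K * (x - 1 / 2) + 2 * (1 - K) * (x - 1 / 2) ^ 2

theorem measurable_lsvLeft (α : ℝ) : Measurable (lsvLeft α) := by
  unfold lsvLeft; fun_prop

theorem measurable_lsvMap (α : ℝ) : Measurable (lsvMap α) :=
  Measurable.ite measurableSet_Iic (measurable_lsvLeft α) (by fun_prop)

theorem measurable_rMap (α K : ℝ) : Measurable (rMap α K) :=
  Measurable.ite measurableSet_Iic (measurable_lsvLeft α) (by fun_prop)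

theorem lsvLeft_eq (α : ℝ) {x : ℝ} (hx : 0 ≤ x) : lsvLeft α x = x * (1 + (2 * x) ^ α) := by
  rw [lsvLeft, Real.mul_rpow (by norm_num) hx]

theorem lsvLeft_mem_Icc {α x : ℝ} (hα : 0 < α) (hx : 0 ≤ x) (hx' : x ≤ 1 / 2) :
    lsvLeft α x ∈ Icc (0 : ℝ) 1 := by
  have h0 : 0 ≤ (2 * x) ^ α := by positivity
  have h1 : (2 * x) ^ α ≤ 1 := Real.rpow_le_one (by positivity) (by linarith) hα.le
  rw [lsvLeft_eq α hx]
  constructor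
  · positivity
  · nlinarith

theorem lsvMap_mem_Icc {α x : ℝ} (hα : 0 < α) (hx : x ∈ Icc (0 : ℝ) 1) :
    lsvMap α x ∈ Icc (0 : ℝ) 1 := by
  unfold lsvMap
  split_ifs with h
  · exact lsvLeft_mem_Icc hα hx.1 h
  · constructor <;> linarith [hx.2]

theorem rMap_mem_Icc {α K x : ℝ} (hα : 0 < α) (hK : K ∈ Ioo (0 : ℝ) 1) (hx : x ∈ Icc (0 : ℝ) 1) :
    rMap α K x ∈ Icc (0 : ℝ) 1 := by
  unfold rMap
  split_ifs with h
  · exact lsvLeft_mem_Icc hα hx.1 h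
  · obtain ⟨hK0, hK1⟩ := hK
    have h1 : 0 < x - 1 / 2 := by linarith
    have h2 : x - 1 / 2 ≤ 1 / 2 := by linarith [hx.2]
    constructor
    · have : 0 < 1 - K := by linarith
      positivity
    · nlinarith [mul_nonneg (mul_nonneg h1.le (sub_nonneg.2 h2)) (sub_nonneg.2 hK1.le)]

/-- The function `x ^ (-a)` decreases by at most `2 ^ a` along the left branch. -/
theorem rpow_neg_le_lsvLeft {a α x : ℝ} (ha : 0 < a) (ha1 : a < 1) (haα : a ≤ α)
    (hx : 0 < x) (hx' : x ≤ 1 / 2) :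
    x ^ (-a) ≤ lsvLeft α x ^ (-a) + 2 ^ a := by
  set t := (2 * x) ^ a with ht
  have ht0 : 0 < t := by positivity
  have hle : lsvLeft α x ≤ x * (1 + t) := by
    rw [lsvLeft_eq α hx.le]
    have := Real.rpow_le_rpow_of_exponent_ge (by positivity) (by linarith : 2 * x ≤ 1) haα
    gcongr
  have hpos : 0 < lsvLeft α x := by
    rw [lsvLeft_eq α hx.le]; positivity
  have h1 : (x * (1 + t)) ^ (-a) ≤ lsvLeft α x ^ (-a) :=
    Real.rpow_le_rpow_of_nonpos hpos hle (by linarith)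
  have h2 : 1 - t ≤ (1 + t) ^ (-a) := by
    have h3 : (1 + t) ^ (-1 : ℝ) ≤ (1 + t) ^ (-a) :=
      Real.rpow_le_rpow_of_exponent_le (by linarith) (by linarith)
    have h4 : 1 - t ≤ (1 + t) ^ (-1 : ℝ) := by
      rw [Real.rpow_neg_one, ← one_div, le_div_iff₀ (by positivity)]
      nlinarith
    exact h4.trans h3
  have h5 : x ^ (-a) * t = 2 ^ a := by
    rw [ht, Real.mul_rpow (by norm_num) hx.le, Real.rpow_neg hx.le]
    field_simp
  rw [Real.mul_rpow hx.le (by positivity)] at h1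
  have h6 : 0 < x ^ (-a) := by positivity
  nlinarith [mul_le_mul_of_nonneg_left h2 h6.le]

theorem exists_iterate_rMap_gt_half (α K : ℝ) {x : ℝ} (hα : 0 < α) (hx : 0 < x) :
    ∃ n, 1 / 2 < (rMap α K)^[n] x := by
  by_contra! hcon
  set t := (2 * x) ^ α with ht
  have ht0 : 0 < t := by positivity
  have key : ∀ n : ℕ, x * (1 + t) ^ n ≤ (rMap α K)^[n] x := by
    intro n
    induction n with
    | zero => simp
    | succ n ih =>
      rw [Function.iterate_succ_apply']
      set y := (rMap α K)^[n] x with hy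
      have hxy : x ≤ y := (le_mul_of_one_le_right hx.le (one_le_pow₀ (by linarith))).trans ih
      rw [rMap, if_pos (hcon n), lsvLeft_eq α (hx.le.trans hxy), pow_succ, ← mul_assoc]
      have hy0 : 0 ≤ y := hx.le.trans hxy
      have hty : t ≤ (2 * y) ^ α := by rw [ht]; gcongr
      gcongr
  obtain ⟨n, hn⟩ := pow_unbounded_of_one_lt (1 / 2 / x) (by linarith : 1 < 1 + t)
  rw [div_lt_iff₀ hx] at hn
  linarith [key n, hcon n]

/-- Every orbit of `R_{α,K}` starting in `(0,1]` hits `1` or any given right neighbourhood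
of `1/2`. -/
theorem exists_iterate_rMap_mem {α K x δ : ℝ} (hα : 0 < α) (hK : K ∈ Ioo (0 : ℝ) 1) (hδ : 0 < δ)
    (hx : x ∈ Ioc (0 : ℝ) 1) :
    ∃ n, (rMap α K)^[n] x ∈ Ioo (1 / 2 : ℝ) (1 / 2 + δ) ∪ {1} := by
  obtain ⟨m, hm⟩ := exists_iterate_rMap_gt_half α K hα hx.1
  have hmaps : MapsTo (rMap α K) (Icc 0 1) (Icc 0 1) := fun _ h => rMap_mem_Icc hα hK h
  have hm1 : (rMap α K)^[m] x ≤ 1 := (hmaps.iterate m ⟨hx.1.le, hx.2⟩).2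
  set y := (rMap α K)^[m] x with hy
  obtain h1 | h1 := hm1.eq_or_lt
  · exact ⟨m, Or.inr h1⟩
  obtain ⟨hK0, hK1⟩ := hK
  set u := y - 1 / 2 with hu
  have hu0 : 0 < u := by linarith
  have hu1 : u < 1 / 2 := by linarith
  set ρ := K + 2 * (1 - K) * u with hρ
  have hρ0 : 0 < ρ := by nlinarith
  have hρ1 : ρ < 1 := by nlinarith
  have key : ∀ n : ℕ, 1 / 2 < (rMap α K)^[n] y ∧ (rMap α K)^[n] y ≤ 1 / 2 + u * ρ ^ n := by
    intro n
    induction n with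
    | zero => exact ⟨hm, by simp [hu]⟩
    | succ n ih =>
      rw [Function.iterate_succ_apply']
      set z := (rMap α K)^[n] y with hz
      obtain ⟨hz1, hz2⟩ := ih
      have hzu : z - 1 / 2 ≤ u := by
        have := mul_le_of_le_one_right hu0.le (pow_le_one₀ hρ0.le hρ1.le (n := n))
        linarith
      have hw : 0 < z - 1 / 2 := by linarith
      have hK' : 0 < 1 - K := by linarith
      rw [rMap, if_neg (not_le.2 hz1)]
      refine ⟨by
        have : 0 < K * (z - 1 / 2) + 2 * (1 - K) * (z - 1 / 2) ^ 2 := by positivity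
        linarith, ?_⟩
      calc 1 / 2 + K * (z - 1 / 2) + 2 * (1 - K) * (z - 1 / 2) ^ 2
          = 1 / 2 + (z - 1 / 2) * (K + 2 * (1 - K) * (z - 1 / 2)) := by ring
        _ ≤ 1 / 2 + (u * ρ ^ n) * ρ := by
          have h3 : K + 2 * (1 - K) * (z - 1 / 2) ≤ ρ := by rw [hρ]; gcongr
          gcongr
          linarith
        _ = _ := by ring
  obtain ⟨n, hn⟩ := exists_pow_lt_of_lt_one hδ hρ1
  refine ⟨n + m, Or.inl ?_⟩
  rw [Function.iterate_add_apply]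
  refine ⟨(key n).1, (key n).2.trans_lt ?_⟩
  have : 0 < ρ ^ n := by positivity
  nlinarith

/-- If a null set `B` has null preimages under all iterates and almost every orbit hits `B`,
the measure vanishes. -/
theorem measure_univ_eq_zero_of_iterate_mem {X : Type*} [MeasurableSpace X] {μ : Measure X}
    {f : X → X} {B : Set X} (hf : ∀ A, MeasurableSet A → μ A = 0 → μ (f ⁻¹' A) = 0)
    (hfm : Measurable f) (hBm : MeasurableSet B) (hB : μ B = 0)
    (hit : ∀ᵐ x ∂μ, ∃ n, f^[n] x ∈ B) : μ univ = 0 := by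
  have hn : ∀ n, μ (f^[n] ⁻¹' B) = 0 := by
    intro n
    induction n with
    | zero => simpa using hB
    | succ n ih =>
      rw [Function.iterate_succ, preimage_comp]
      exact hf _ ((hfm.iterate n) hBm) ih
  have h1 : ∀ᵐ x ∂μ, x ∉ ⋃ n, f^[n] ⁻¹' B :=
    measure_eq_zero_iff_ae_notMem.1 (measure_iUnion_null hn)
  have h2 : ∀ᵐ x ∂μ, False := by
    filter_upwards [hit, h1] with x hx hx'
    exact hx' (mem_iUnion.2 hx)
  simpa [ae_iff] using h2

/-- A stationarity relation for sets is inherited by integrals of nonnegative functions. -/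
theorem lintegral_eq_sum_of_stationary {ι X : Type*} [Fintype ι] [MeasurableSpace X]
    {μ : Measure X} {S : Set X} (hS : MeasurableSet S) (hμS : ∀ᵐ x ∂μ, x ∈ S)
    {T : ι → X → X} (hTm : ∀ j, Measurable (T j)) (hTS : ∀ j, MapsTo (T j) S S)
    {p : ι → ENNReal}
    (hinv : ∀ A, MeasurableSet A → A ⊆ S → ∑ j, p j * μ (T j ⁻¹' A) = μ A)
    {g : X → ENNReal} (hg : Measurable g) :
    ∫⁻ x, g x ∂μ = ∑ j, p j * ∫⁻ x, g (T j x) ∂μ := by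
  have hμ : μ = Measure.sum fun j => p j • μ.map (T j) := by
    ext A hA
    rw [Measure.sum_apply _ hA, tsum_fintype]
    have h1 : μ A = μ (A ∩ S) := by
      refine measure_congr ?_
      filter_upwards [hμS] with x hx
      simp only [eq_iff_iff]
      exact ⟨fun h => ⟨h, hx⟩, fun h => h.1⟩
    rw [h1, ← hinv _ (hA.inter hS) inter_subset_right]
    refine Finset.sum_congr rfl fun j _ => ?_
    rw [Measure.smul_apply, Measure.map_apply (hTm j) hA, smul_eq_mul]
    congr 1
    refine measure_congr ?_
    filter_upwards [hμS] with x hx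
    simp only [eq_iff_iff]
    exact ⟨fun h => h.1, fun h => ⟨h, hTS j hx⟩⟩
  conv_lhs => rw [hμ]
  rw [lintegral_sum_measure, tsum_fintype]
  refine Finset.sum_congr rfl fun j _ => ?_
  rw [lintegral_smul_measure, lintegral_map hg (hTm j), smul_eq_mul]

/-- A strict growth rate at a positive base point persists nearby. -/
theorem exists_pos_one_lt_sum {ι : Type*} (s : Finset ι) (p K : ι → ℝ) (a : ℝ)
    (hK : ∀ r ∈ s, K r ∈ Ioo (0 : ℝ) 1) (h : 1 < ∑ r ∈ s, p r * K r ^ (-a)) :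
    ∃ δ > 0, 1 < ∑ r ∈ s, p r * (K r + 2 * (1 - K r) * δ) ^ (-a) := by
  have hcont : ContinuousAt (fun δ : ℝ => ∑ r ∈ s, p r * (K r + 2 * (1 - K r) * δ) ^ (-a)) 0 := by
    refine tendsto_finsetSum _ fun r hr => ?_
    refine ContinuousAt.mul continuousAt_const (ContinuousAt.rpow_const (by fun_prop) ?_)
    left
    simpa using (hK r hr).1.ne'
  have hev : ∀ᶠ δ in nhds (0 : ℝ), 1 < ∑ r ∈ s, p r * (K r + 2 * (1 - K r) * δ) ^ (-a) :=
    hcont.eventually_const_lt (by simpa using h)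
  have hev' := (hev.filter_mono nhdsWithin_le_nhds : ∀ᶠ δ in nhdsWithin (0 : ℝ) (Ioi 0), _)
  obtain ⟨δ, h1, h2⟩ := (hev'.and self_mem_nhdsWithin).exists
  exact ⟨δ, h2, h1⟩

/-- Theorem 1.1: if `η > 1` then `F` admits no absolutely continuous stationary
probability measure. -/
theorem no_acs_probability_of_eta_gt_one
    (N : ℕ) (hN : 0 < N)
    (α K : Fin N → ℝ) (SR : Finset (Fin N))
    (hSR : SR.Nonempty) (hSS : SRᶜ.Nonempty)
    (hα : ∀ j, 0 < α j)
    (hK : ∀ r ∈ SR, K r ∈ Set.Ioo (0 : ℝ) 1)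
    (T : Fin N → ℝ → ℝ)
    (hT : ∀ j, T j = if j ∈ SR then rMap (α j) (K j) else lsvMap (α j))
    (αmin : ℝ) (hαmin : IsLeast (Set.range α) αmin) (hαmin1 : αmin < 1)
    (p : Fin N → ℝ) (hp : ∀ j, 0 < p j) (hp1 : ∑ j, p j = 1)
    (hη : 1 < ∑ r ∈ SR, p r * K r ^ (-αmin)) :
    ¬ ∃ μ : Measure ℝ, IsProbabilityMeasure μ ∧
        μ ≪ volume.restrict (Set.Icc (0 : ℝ) 1) ∧
        ∀ A : Set ℝ, MeasurableSet A → A ⊆ Set.Icc (0 : ℝ) 1 →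
          ∑ j, ENNReal.ofReal (p j) * μ (T j ⁻¹' A) = μ A := by
  rintro ⟨μ, hμ, hac, hinv⟩
  obtain ⟨j₀, hj₀⟩ := hαmin.1
  have ha : 0 < αmin := hj₀ ▸ hα j₀
  have haα : ∀ j, αmin ≤ α j := fun j => hαmin.2 (mem_range_self j)
  obtain ⟨s, hs⟩ := hSS
  obtain ⟨r, hr⟩ := hSR
  have hTs : T s = lsvMap (α s) := by rw [hT, if_neg (Finset.mem_compl.1 hs)]
  have hTR : ∀ j ∈ SR, T j = rMap (α j) (K j) := fun j hj => by rw [hT, if_pos hj]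
  have hTm : ∀ j, Measurable (T j) := by
    intro j
    rw [hT]
    split_ifs
    exacts [measurable_rMap _ _, measurable_lsvMap _]
  have hTI : ∀ j, MapsTo (T j) (Icc 0 1) (Icc 0 1) := by
    intro j x hx
    rw [hT]
    split_ifs with h
    exacts [rMap_mem_Icc (hα j) (hK j h) hx, lsvMap_mem_Icc (hα j) hx]
  have hTl : ∀ j x, x ≤ 1 / 2 → T j x = lsvLeft (α j) x := by
    intro j x hx
    rw [hT]
    split_ifs
    exacts [if_pos hx, if_pos hx]
  have hμI : ∀ᵐ x ∂μ, x ∈ Icc (0 : ℝ) 1 := hac.ae_le (ae_restrict_mem measurableSet_Icc)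
  have hμpt : ∀ c : ℝ, μ {c} = 0 := fun c =>
    hac (le_antisymm ((Measure.restrict_apply_le _ _).trans (by simp)) bot_le)
  have hμpos : ∀ᵐ x ∂μ, x ∈ Ioc (0 : ℝ) 1 := by
    filter_upwards [hμI, measure_eq_zero_iff_ae_notMem.1 (hμpt 0)] with x hx hx0
    exact ⟨lt_of_le_of_ne hx.1 fun h => hx0 h.symm, hx.2⟩
  have hlint : ∀ g : ℝ → ENNReal, Measurable g →
      ∫⁻ x, g x ∂μ = ∑ j, ENNReal.ofReal (p j) * ∫⁻ x, g (T j x) ∂μ := fun g hg =>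
    lintegral_eq_sum_of_stationary measurableSet_Icc hμI hTm hTI hinv hg
  have hlint' : ∀ g : ℝ → ENNReal, Measurable g →
      ∫⁻ x, ∑ j, ENNReal.ofReal (p j) * g (T j x) ∂μ = ∫⁻ x, g x ∂μ := by
    intro g hg
    have hgT : ∀ j, Measurable fun x => g (T j x) := fun j => hg.comp (hTm j)
    rw [lintegral_finsetSum _ fun j _ => (hgT j).const_mul _, hlint g hg]
    exact Finset.sum_congr rfl fun j _ => lintegral_const_mul _ (hgT j)
  have hpsum : ∑ j, ENNReal.ofReal (p j) = 1 := by
    rw [← ENNReal.ofReal_sum_of_nonneg fun j _ => (hp j).le, hp1, ENNReal.ofReal_one]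
  set ψ : ℝ → ENNReal := fun x => ENNReal.ofReal ((2 * x - 1) ^ (-αmin)) with hψ
  have hψm : Measurable ψ := by fun_prop
  have hψfin : ∫⁻ x, (Ioi (1 / 2)).indicator ψ x ∂μ ≠ ⊤ := by
    set c : ENNReal := ENNReal.ofReal (2 ^ αmin) with hc
    set V : ℕ → ℝ → ENNReal := fun M x => ENNReal.ofReal (min (x ^ (-αmin)) M) with hV
    have hVm : ∀ M, Measurable (V M) := fun M => by fun_prop
    have hpt : ∀ M, ∀ x ∈ Ioc (0 : ℝ) 1,
        V M x + ENNReal.ofReal (p s) * (Ioi (1 / 2)).indicator (fun x => V M (2 * x - 1)) x ≤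
          ∑ j, ENNReal.ofReal (p j) * V M (T j x) + c := by
      intro M x hx
      by_cases h : x ≤ 1 / 2
      · rw [indicator_of_notMem (by simpa using h), mul_zero, add_zero]
        have hle : ∀ j, V M x ≤ V M (T j x) + c := by
          intro j
          rw [hTl j x h]
          refine (ENNReal.ofReal_le_ofReal ?_).trans ENNReal.ofReal_add_le
          have h1 := rpow_neg_le_lsvLeft ha hαmin1 (haα j) hx.1 h
          have h2 : (0 : ℝ) < 2 ^ αmin := by positivity
          rw [← min_add_add_right]
          exact min_le_min h1 (by linarith)
        calc V M x = ∑ j, ENNReal.ofReal (p j) * V M x := by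
              rw [← Finset.sum_mul, hpsum, one_mul]
          _ ≤ ∑ j, ENNReal.ofReal (p j) * (V M (T j x) + c) := by gcongr with j; exact hle j
          _ = _ := by
              simp_rw [mul_add]
              rw [Finset.sum_add_distrib, ← Finset.sum_mul, hpsum, one_mul]
      · have h' : 1 / 2 < x := not_le.1 h
        rw [indicator_of_mem (by simpa using h'), add_comm]
        refine add_le_add ?_ ?_
        · have : 2 * x - 1 = T s x := by rw [hTs, lsvMap, if_neg h]
          rw [this]
          exact Finset.single_le_sum (f := fun j => ENNReal.ofReal (p j) * V M (T j x))
            (fun _ _ => bot_le) (Finset.mem_univ s)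
        · refine ENNReal.ofReal_le_ofReal ((min_le_left _ _).trans ?_)
          calc x ^ (-αmin) ≤ (1 / 2 : ℝ) ^ (-αmin) :=
                Real.rpow_le_rpow_of_nonpos (by norm_num) h'.le (by linarith)
            _ = 2 ^ αmin := by
                rw [one_div, Real.inv_rpow (by norm_num), Real.rpow_neg (by norm_num), inv_inv]
    set W : ℕ → ℝ → ENNReal := fun M => (Ioi (1 / 2)).indicator fun x => V M (2 * x - 1) with hW
    have hWm : ∀ M, Measurable (W M) := fun M =>
      ((hVm M).comp (by fun_prop)).indicator measurableSet_Ioi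
    have hps : ENNReal.ofReal (p s) ≠ 0 := by simpa using hp s
    have hbound : ∀ M, ∫⁻ x, W M x ∂μ ≤ c / ENNReal.ofReal (p s) := by
      intro M
      have hfin : ∫⁻ x, V M x ∂μ ≠ ⊤ := by
        refine ((lintegral_mono fun x =>
          ENNReal.ofReal_le_ofReal (min_le_right _ (M : ℝ))).trans_lt ?_).ne
        simp
      have hint : ∫⁻ x, V M x ∂μ + ENNReal.ofReal (p s) * ∫⁻ x, W M x ∂μ ≤
          ∫⁻ x, V M x ∂μ + c := by
        have := lintegral_mono_ae (hμpos.mono (hpt M))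
        rw [lintegral_add_left (hVm M), lintegral_const_mul _ (hWm M),
          lintegral_add_right _ measurable_const, hlint' _ (hVm M)] at this
        simpa using this
      rw [ENNReal.le_div_iff_mul_le (Or.inl hps) (Or.inl ENNReal.ofReal_ne_top), mul_comm]
      exact (ENNReal.add_le_add_iff_left hfin).1 hint
    have htend : Filter.Tendsto (fun M => ∫⁻ x, W M x ∂μ) Filter.atTop
        (nhds (∫⁻ x, (Ioi (1 / 2)).indicator ψ x ∂μ)) := by
      refine lintegral_tendsto_of_tendsto_of_monotone (fun M => (hWm M).aemeasurable) ?_ ?_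
      · refine ae_of_all _ fun x M M' hMM' => ?_
        refine indicator_le_indicator (ENNReal.ofReal_le_ofReal (min_le_min le_rfl ?_))
        exact_mod_cast hMM'
      · refine ae_of_all _ fun x => ?_
        obtain ⟨M₀, hM₀⟩ := exists_nat_ge ((2 * x - 1) ^ (-αmin))
        refine tendsto_const_nhds.congr' ?_
        filter_upwards [Filter.eventually_ge_atTop M₀] with M hM
        have : (2 * x - 1) ^ (-αmin) ≤ (M : ℝ) := hM₀.trans (by exact_mod_cast hM)
        simp only [hW, hV, hψ, indicator, min_eq_left this]
    exact ne_top_of_le_ne_top (ENNReal.div_ne_top ENNReal.ofReal_ne_top hps)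
      (le_of_tendsto' htend hbound)
  obtain ⟨δ, hδ, hη'⟩ := exists_pos_one_lt_sum SR p K αmin hK hη
  have hcoef : ∀ j ∈ SR, 0 ≤ p j * (K j + 2 * (1 - K j) * δ) ^ (-αmin) := by
    intro j hj
    have h1 := (hK j hj).1
    have h2 : 0 < 1 - K j := sub_pos.2 (hK j hj).2
    have h3 := hp j
    positivity
  set δ' := min δ (1 / 2) with hδ'
  have hδ'0 : 0 < δ' := lt_min hδ (by norm_num)
  set Φ : ℝ → ENNReal := (Ioo (1 / 2) (1 / 2 + δ')).indicator ψ with hΦ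
  have hΦm : Measurable Φ := hψm.indicator measurableSet_Ioo
  have hΦfin : ∫⁻ x, Φ x ∂μ ≠ ⊤ :=
    ne_top_of_le_ne_top hψfin (lintegral_mono fun x =>
      indicator_le_indicator_of_subset Ioo_subset_Ioi_self (fun _ => bot_le) x)
  set η := ∑ r ∈ SR, p r * (K r + 2 * (1 - K r) * δ) ^ (-αmin) with hηdef
  have hgrow : ∀ x, ENNReal.ofReal η * Φ x ≤ ∑ j, ENNReal.ofReal (p j) * Φ (T j x) := by
    intro x
    by_cases hx : x ∈ Ioo (1 / 2) (1 / 2 + δ')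
    · refine le_trans ?_ (Finset.sum_le_univ_sum_of_nonneg (s := SR) fun _ => bot_le)
      rw [hηdef, ENNReal.ofReal_sum_of_nonneg hcoef, Finset.sum_mul]
      refine Finset.sum_le_sum fun j hj => ?_
      obtain ⟨hK0, hK1⟩ := hK j hj
      have hu : 0 < x - 1 / 2 := by linarith [hx.1]
      have huδ : x - 1 / 2 < δ := by linarith [hx.2, min_le_left δ (1 / 2)]
      have huh : x - 1 / 2 < 1 / 2 := by linarith [hx.2, min_le_right δ (1 / 2)]
      have hK' : 0 < 1 - K j := sub_pos.2 hK1
      set m := K j + 2 * (1 - K j) * (x - 1 / 2) with hm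
      have hm0 : 0 < m := by positivity
      have hm1 : m < 1 := by nlinarith
      have hTx : T j x = 1 / 2 + m * (x - 1 / 2) := by
        rw [hTR j hj, rMap, if_neg (not_le.2 hx.1)]; ring
      have hTmem : T j x ∈ Ioo (1 / 2) (1 / 2 + δ') := by
        rw [hTx]
        constructor
        · have := mul_pos hm0 hu
          linarith
        · nlinarith [hx.2]
      rw [hΦ, indicator_of_mem hx, indicator_of_mem hTmem, hψ]
      simp only
      rw [← ENNReal.ofReal_mul (hcoef j hj), ← ENNReal.ofReal_mul (hp j).le]
      refine ENNReal.ofReal_le_ofReal ?_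
      have h2 : 2 * T j x - 1 = m * (2 * x - 1) := by rw [hTx]; ring
      have h3 : 0 < 2 * x - 1 := by linarith
      rw [h2, Real.mul_rpow hm0.le h3.le, mul_assoc]
      have h4 : (K j + 2 * (1 - K j) * δ) ^ (-αmin) ≤ m ^ (-αmin) := by
        refine Real.rpow_le_rpow_of_nonpos hm0 ?_ (by linarith)
        rw [hm]
        gcongr
      have := (hp j).le
      gcongr
    · rw [hΦ, indicator_of_notMem hx, mul_zero]
      exact bot_le
  have hΦ0 : ∫⁻ x, Φ x ∂μ = 0 := by
    have h1 : ENNReal.ofReal η * ∫⁻ x, Φ x ∂μ ≤ 1 * ∫⁻ x, Φ x ∂μ := by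
      rw [one_mul, ← lintegral_const_mul _ hΦm]
      exact (lintegral_mono hgrow).trans_eq (hlint' _ hΦm)
    by_contra h0
    have h2 := (ENNReal.mul_le_mul_iff_left h0 hΦfin).1 h1
    rw [ENNReal.ofReal_le_one] at h2
    linarith
  have hB : μ (Ioo (1 / 2) (1 / 2 + δ') ∪ {1}) = 0 := by
    refine measure_union_null ?_ (hμpt 1)
    rw [measure_eq_zero_iff_ae_notMem]
    filter_upwards [(lintegral_eq_zero_iff hΦm).1 hΦ0] with x hx hmem
    have h3 : 0 < 2 * x - 1 := by linarith [hmem.1]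
    rw [hΦ, indicator_of_mem hmem, hψ] at hx
    have h4 : (0 : ℝ) < (2 * x - 1) ^ (-αmin) := by positivity
    exact (ENNReal.ofReal_pos.2 h4).ne' hx
  have hnull : ∀ A, MeasurableSet A → μ A = 0 → μ (T r ⁻¹' A) = 0 := by
    intro A hA hA0
    have h1 := hlint (A.indicator 1) (measurable_one.indicator hA)
    rw [lintegral_indicator_one hA, hA0] at h1
    have h2 := (Finset.sum_eq_zero_iff.1 h1.symm) r (Finset.mem_univ r)
    have h3 := (mul_eq_zero.1 h2).resolve_left (by simpa using hp r)
    rw [← lintegral_indicator_one (hTm r hA), ← h3]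
    rfl
  have hzero := measure_univ_eq_zero_of_iterate_mem hnull (hTm r)
    (measurableSet_Ioo.union (measurableSet_singleton 1)) hB (by
      filter_upwards [hμpos] with x hx
      rw [hTR r hr]
      exact exists_iterate_rMap_mem (hα r) (hK r hr) hδ'0 hx)
  rw [measure_univ] at hzero
  exact one_ne_zero hzero
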